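/- Let n ≥ 2, 1 < p < ∞ with p ≠ n, R > 0, δ > 0, β > 0, and let γ₁ = β / [ (R+δ)^{−(n−1)/(p−1)} + ((p−1)/(p−n)) β^{1/(p−1)} R^{(p−n)/(p−1)} ( ((R+δ)/R)^{(p−n)/(p−1)} − 1 ) ]^{p−1}. Define u : [R, R+δ] → ℝ by u(r) = 1 − γ₁^{1/(p−1)} ((p−1)/(p−n)) R^{(p−n)/(p−1)} [ (r/R)^{(p−n)/(p−1)} − 1 ]. Then u satisfies: (i) u'(r) = −γ₁^{1/(p−1)} r^{−(n−1)/(p−1)} for all r ∈ [R, R+δ], hence r^{n−1} |u'(r)|^{p−2} u'(r) is constant in r; (ii) u(R) = 1; (iii) the Robin boundary condition −(−u'(R+δ))^{p−1} + β (u(R+δ))^{p−1} = 0. -/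

import Mathlib

open Set
noncomputable section

/-- The function `a⁻¹ R^a ((r/R)^a - 1)` is the primitive of `r^(a-1)` vanishing at `R`. -/
lemma hasDerivAt_primitive_rpow {a R r : ℝ} (ha : a ≠ 0) (hR : 0 < R) (hr : 0 < r) :
    HasDerivAt (fun x : ℝ => a⁻¹ * R ^ a * ((x / R) ^ a - 1)) (r ^ (a - 1)) r := by
  have h := ((((hasDerivAt_id r).div_const R).rpow_const (p := a)
    (Or.inl (div_pos hr hR).ne')).sub_const 1).const_mul (a⁻¹ * R ^ a)
  refine h.congr_deriv ?_
  simp only [id]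
  rw [Real.div_rpow hr.le hR.le, Real.rpow_sub_one hR.ne']
  have := (Real.rpow_pos_of_pos hR a).ne'
  field_simp

/-- The primitive of `x^(a-1)` vanishing at `R` is nonnegative to the right of `R`. -/
lemma primitive_rpow_nonneg {a R r : ℝ} (hR : 0 < R) (hr : R ≤ r) :
    0 ≤ a⁻¹ * R ^ a * ((r / R) ^ a - 1) := by
  have h1 : 1 ≤ r / R := (one_le_div hR).2 hr
  have hRa := Real.rpow_nonneg hR.le a
  rcases le_total 0 a with ha | ha
  · exact mul_nonneg (mul_nonneg (inv_nonneg.2 ha) hRa)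
      (sub_nonneg.2 (Real.one_le_rpow h1 ha))
  · exact mul_nonneg_of_nonpos_of_nonpos
      (mul_nonpos_of_nonpos_of_nonneg (inv_nonpos.2 ha) hRa)
      (sub_nonpos.2 (Real.rpow_le_one_of_one_le_of_nonpos h1 ha))

/-- The radial flux `r^m |v|^(p-2) v` of the velocity `v = -c r^(-m/(p-1))` equals `-c^(p-1)`. -/
lemma radial_flux_eq {p m c r : ℝ} (hp : 1 < p) (hc : 0 < c) (hr : 0 < r) :
    r ^ m * |-c * r ^ (-(m / (p - 1)))| ^ (p - 2) * (-c * r ^ (-(m / (p - 1)))) =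
      -c ^ (p - 1) := by
  have hp1 : p - 1 ≠ 0 := (sub_pos.2 hp).ne'
  have hrm := Real.rpow_pos_of_pos hr (-(m / (p - 1)))
  have hv : 0 < c * r ^ (-(m / (p - 1))) := mul_pos hc hrm
  rw [neg_mul, abs_neg, abs_of_pos hv, mul_neg, mul_assoc, neg_inj,
    ← Real.rpow_add_one hv.ne', show p - 2 + 1 = p - 1 by ring,
    Real.mul_rpow hc.le hrm.le, ← Real.rpow_mul hr.le, neg_mul, div_mul_cancel₀ _ hp1,
    mul_left_comm, ← Real.rpow_add hr, add_neg_cancel, Real.rpow_zero, mul_one]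

/-- The explicit radial profile
`u(r) = 1 − γ₁^{1/(p-1)} ((p-1)/(p-n)) R^{(p-n)/(p-1)} [(r/R)^{(p-n)/(p-1)} − 1]`
(with the explicit constant `γ₁`) satisfies, on `[R, R+δ]`:
(i) `u'(r) = −γ₁^{1/(p-1)} r^{−(n-1)/(p-1)}`, so that
`r^{n-1} |u'(r)|^{p-2} u'(r)` is constant in `r` (i.e. `u` is a radial
`p`-harmonic function); (ii) `u(R) = 1`; (iii) the Robin boundary condition
`−(−u'(R+δ))^{p-1} + β (u(R+δ))^{p-1} = 0`. -/
theorem radial_solution_properties {n : ℕ} (hn : 2 ≤ n) (p R δ β γ₁ : ℝ)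
    (hp : 1 < p) (hpn : p ≠ (n : ℝ)) (hR : 0 < R) (hδ : 0 < δ) (hβ : 0 < β)
    (hγ : γ₁ = β /
      ((R + δ) ^ (-(((n : ℝ) - 1) / (p - 1))) +
        ((p - 1) / (p - (n : ℝ))) * β ^ ((1 : ℝ) / (p - 1)) *
          R ^ ((p - (n : ℝ)) / (p - 1)) *
          (((R + δ) / R) ^ ((p - (n : ℝ)) / (p - 1)) - 1)) ^ (p - 1))
    (u : ℝ → ℝ)
    (hu : u = fun r : ℝ => 1 -
      γ₁ ^ ((1 : ℝ) / (p - 1)) * ((p - 1) / (p - (n : ℝ))) *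
        R ^ ((p - (n : ℝ)) / (p - 1)) * ((r / R) ^ ((p - (n : ℝ)) / (p - 1)) - 1)) :
    (∀ r ∈ Icc R (R + δ),
        HasDerivAt u (-(γ₁ ^ ((1 : ℝ) / (p - 1))) * r ^ (-(((n : ℝ) - 1) / (p - 1)))) r) ∧
    (∀ r ∈ Icc R (R + δ), ∀ s ∈ Icc R (R + δ),
        r ^ ((n : ℝ) - 1) * |deriv u r| ^ (p - 2) * deriv u r =
          s ^ ((n : ℝ) - 1) * |deriv u s| ^ (p - 2) * deriv u s) ∧
    u R = 1 ∧
    -((-deriv u (R + δ)) ^ (p - 1)) + β * u (R + δ) ^ (p - 1) = 0 := by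
  have hq : 0 < p - 1 := sub_pos.2 hp
  have hRδ : 0 < R + δ := add_pos hR hδ
  have hpn' : p - (n : ℝ) ≠ 0 := sub_ne_zero.2 hpn
  set a : ℝ := (p - (n : ℝ)) / (p - 1) with ha_def
  have ha : a ≠ 0 := div_ne_zero hpn' hq.ne'
  have hinv : (p - 1) / (p - (n : ℝ)) = a⁻¹ := (inv_div _ _).symm
  have ha1 : a - 1 = -(((n : ℝ) - 1) / (p - 1)) := by
    rw [ha_def]
    field_simp
    ring
  rw [hinv] at hγ hu
  set A : ℝ := (R + δ) ^ (-(((n : ℝ) - 1) / (p - 1))) with hA_def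
  have hA : 0 < A := Real.rpow_pos_of_pos hRδ _
  set b : ℝ := β ^ ((1 : ℝ) / (p - 1)) with hb_def
  have hb : 0 < b := Real.rpow_pos_of_pos hβ _
  have hbq : b ^ (p - 1) = β := by
    rw [hb_def, ← Real.rpow_mul hβ.le, one_div_mul_cancel hq.ne', Real.rpow_one]
  obtain ⟨K, hK⟩ : ∃ K, K = a⁻¹ * R ^ a * (((R + δ) / R) ^ a - 1) := ⟨_, rfl⟩
  have hK0 : 0 ≤ K := hK ▸ primitive_rpow_nonneg hR (by linarith)
  have hD : 0 < A + b * K := by positivity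
  have hc : γ₁ ^ ((1 : ℝ) / (p - 1)) = b / (A + b * K) := by
    rw [hγ, show A + a⁻¹ * b * R ^ a * (((R + δ) / R) ^ a - 1) = A + b * K by rw [hK]; ring,
      Real.div_rpow hβ.le (by positivity), ← Real.rpow_mul hD.le,
      mul_one_div_cancel hq.ne', Real.rpow_one]
  rw [hc] at hu ⊢
  have hc0 : 0 < b / (A + b * K) := div_pos hb hD
  have hderiv : ∀ r ∈ Icc R (R + δ), HasDerivAt u
      (-(b / (A + b * K)) * r ^ (-(((n : ℝ) - 1) / (p - 1)))) r := by
    intro r hr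
    have h := ((hasDerivAt_primitive_rpow ha hR (hR.trans_le hr.1)).const_mul
      (b / (A + b * K))).const_sub 1
    rw [ha1, ← neg_mul] at h
    refine h.congr_of_eventuallyEq (.of_forall fun x => ?_)
    rw [hu]
    ring
  have hflux : ∀ r ∈ Icc R (R + δ),
      r ^ ((n : ℝ) - 1) * |deriv u r| ^ (p - 2) * deriv u r = -(b / (A + b * K)) ^ (p - 1) := by
    intro r hr
    rw [(hderiv r hr).deriv]
    exact radial_flux_eq hp hc0 (hR.trans_le hr.1)
  refine ⟨hderiv, fun r hr s hs => (hflux r hr).trans (hflux s hs).symm, ?_, ?_⟩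
  · rw [hu]
    simp [div_self hR.ne']
  · have hu' : u (R + δ) = A / (A + b * K) := by
      have : u (R + δ) = 1 - b / (A + b * K) * K := by
        rw [hu, hK]
        ring
      rw [this]
      field_simp
      ring
    rw [(hderiv (R + δ) ⟨by linarith, le_rfl⟩).deriv, ← hA_def, hu', neg_mul, neg_neg,
      div_mul_eq_mul_div, mul_div_assoc, Real.mul_rpow hb.le (by positivity), hbq]
    ring
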